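/- arXiv:0708.3441 — 2 statements merged into one kernel-verified Lean document; each statement's English description precedes it below -/
import Mathlib

section
/- For every C ∈ ℛ, D ∈ ℛ[r] and a ∈ L, ι(C) · ∫₀^# D da = ∫₀^# (ι(C) · D) da in ℛ[r]. -/
/-- All shuffles (interleavings) of two lists. -/
def shuffles {α : Type*} : List α → List α → List (List α)
  | [], ys => [ys]
  | x :: xs, [] => [x :: xs]
  | x :: xs, y :: ys =>
      ((shuffles xs (y :: ys)).map (x :: ·)) ++ ((shuffles (x :: xs) ys).map (y :: ·))
  termination_by xs ys => xs.length + ys.length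

/-- `ℛ`: the free `ℤ`-module on finite sequences of labels. -/
abbrev CalcR (L : Type) := List L →₀ ℤ

/-- `ℛ[r]`: the free `ℤ`-module on the elements `A ⊗ B`, encoded as pairs of sequences. -/
abbrev CalcRr (L : Type) := (List L × List L) →₀ ℤ

/-- The shuffle product of two basis sequences. -/
noncomputable def shuffleBase {L : Type} (A B : List L) : CalcR L :=
  ((shuffles A B).map fun s => Finsupp.single s (1 : ℤ)).sum

/-- The shuffle product on `ℛ`. -/
noncomputable def rmul {L : Type} (X Y : CalcR L) : CalcR L :=
  X.sum fun A cA => Y.sum fun B cB => (cA * cB) • shuffleBase A B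

/-- The unit `∅` of `ℛ`. -/
noncomputable def rone (L : Type) : CalcR L := Finsupp.single [] 1

/-- The product `(A⊗B)(C⊗D) = (AC)⊗(BD)` of two basis elements of `ℛ[r]`. -/
noncomputable def pairBase {L : Type} (p q : List L × List L) : CalcRr L :=
  ((shuffles p.1 q.1).flatMap fun s =>
    (shuffles p.2 q.2).map fun t => Finsupp.single (s, t) (1 : ℤ)).sum

/-- The product on `ℛ[r]`. -/
noncomputable def pmul {L : Type} (X Y : CalcRr L) : CalcRr L :=
  X.sum fun p c => Y.sum fun q d => (c * d) • pairBase p q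

/-- The unit `∅ ⊗ ∅` of `ℛ[r]`. -/
noncomputable def pone (L : Type) : CalcRr L := Finsupp.single ([], []) 1

/-- The derivative `∂/∂a` on `ℛ[r]`. -/
noncomputable def pderiv {L : Type} [DecidableEq L] (a : L) (X : CalcRr L) : CalcRr L :=
  X.sum fun p c => c •
    ((if p.1.getLast? = some a then Finsupp.single (p.1.dropLast, p.2) (1 : ℤ) else 0) -
     (if p.2.head? = some a then Finsupp.single (p.1, p.2.tail) (1 : ℤ) else 0))

/-- The embedding `ι : ℛ → ℛ[r]`, `ι(a₁,…,a_n) = Σ_k (a₁,…,a_k) ⊗ (a_{k+1},…,a_n)`. -/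
noncomputable def iotaR {L : Type} (C : CalcR L) : CalcRr L :=
  C.sum fun A c => c • (((List.range (A.length + 1)).map fun k =>
    Finsupp.single (A.take k, A.drop k) (1 : ℤ)).sum)

/-- The value at `0`: `(A⊗B)(0) = B` if `A = ∅` and `0` otherwise. -/
noncomputable def ev0 {L : Type} [DecidableEq L] (X : CalcRr L) : CalcR L :=
  X.sum fun p c => if p.1 = [] then Finsupp.single p.2 c else 0

/-- The value at `1`: `(A⊗B)(1) = A` if `B = ∅` and `0` otherwise. -/
noncomputable def ev1 {L : Type} [DecidableEq L] (X : CalcRr L) : CalcR L :=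
  X.sum fun p c => if p.2 = [] then Finsupp.single p.1 c else 0

/-- The integral `∫₀^# · da` on `ℛ[r]`. -/
noncomputable def integ0 {L : Type} (a : L) (X : CalcRr L) : CalcRr L :=
  X.sum fun p c => c • (((List.range (p.2.length + 1)).map fun k =>
    Finsupp.single (p.1 ++ a :: p.2.take k, p.2.drop k) (1 : ℤ)).sum)

/-- Iterated derivative `∂/∂a₁ ⋯ ∂/∂a_k` along a list `(a₁, …, a_k)`. -/
noncomputable def derivs {L : Type} [DecidableEq L] : List L → CalcRr L → CalcRr L
  | [], F => F
  | a :: w, F => pderiv a (derivs w F)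

section Helpers
variable {L M N : Type} [AddCommMonoid M] [AddCommMonoid N]

/-- Sum over all shuffles. -/
def shS (f : List L → M) (xs ys : List L) : M := ((shuffles xs ys).map f).sum

/-- Sum over all splittings. -/
def spS : (List L → List L → M) → List L → M
  | f, [] => f [] []
  | f, x :: w => f [] (x :: w) + spS (fun u v => f (x :: u) v) w

theorem spS_eq (f : List L → List L → M) (w : List L) :
    ((List.range (w.length + 1)).map fun k => f (w.take k) (w.drop k)).sum = spS f w := by
  induction w generalizing f with
  | nil => simp [spS]
  | cons x w ih =>
    rw [spS, ← ih, List.length_cons, List.range_succ_eq_map]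
    simp [Function.comp_def]

theorem shS_nil_left (f : List L → M) (ys : List L) : shS f [] ys = f ys := by
  simp [shS, shuffles]

theorem shS_nil_right (f : List L → M) (xs : List L) : shS f xs [] = f xs := by
  cases xs <;> simp [shS, shuffles]

theorem shS_cons (f : List L → M) (x y : L) (xs ys : List L) :
    shS f (x :: xs) (y :: ys) =
      shS (fun s => f (x :: s)) xs (y :: ys) + shS (fun s => f (y :: s)) (x :: xs) ys := by
  simp [shS, shuffles, Function.comp_def]

theorem shS_add (f g : List L → M) (xs ys : List L) :
    shS (fun s => f s + g s) xs ys = shS f xs ys + shS g xs ys := by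
  simp [shS, List.sum_map_add]

theorem spS_add (f g : List L → List L → M) (w : List L) :
    spS (fun u v => f u v + g u v) w = spS f w + spS g w := by
  induction w generalizing f g with
  | nil => simp [spS]
  | cons x w ih => simp only [spS, ih]; abel

theorem map_shS (φ : M →+ N) (f : List L → M) (xs ys : List L) :
    φ (shS f xs ys) = shS (fun s => φ (f s)) xs ys := by
  simp [shS, map_list_sum, Function.comp_def]

theorem map_spS (φ : M →+ N) (f : List L → List L → M) (w : List L) :
    φ (spS f w) = spS (fun u v => φ (f u v)) w := by
  induction w generalizing f with
  | nil => simp [spS]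
  | cons x w ih => simp [spS, ih]

theorem shS_spS (f : List L → List L → List L → M) (xs ys w : List L) :
    shS (fun s => spS (f s) w) xs ys = spS (fun u v => shS (fun s => f s u v) xs ys) w := by
  induction w generalizing f with
  | nil => simp [spS]
  | cons x w ih => simp [spS, ← ih, shS_add]

theorem spS_spS (f : List L → List L → List L → List L → M) (w z : List L) :
    spS (fun a b => spS (f a b) z) w = spS (fun u v => spS (fun a b => f a b u v) w) z := by
  induction z generalizing f with
  | nil => simp [spS]
  | cons x z ih => simp [spS, ← ih, spS_add]

theorem spS_coassoc (g : List L → List L → List L → M) (w : List L) :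
    spS (fun w1 w2 => spS (fun u v => g u v w2) w1) w =
      spS (fun u v => spS (fun v1 v2 => g u v1 v2) v) w := by
  induction w generalizing g with
  | nil => simp [spS]
  | cons x w ih => simp only [spS, spS_add, ih]; abel

theorem shS_split (g : List L → List L → M) (v B : List L) :
    shS (fun t => spS g t) v B =
      spS (fun v1 v2 => spS (fun B1 B2 => shS (fun s => shS (fun t => g s t) v2 B2) v1 B1) B) v := by
  induction v generalizing g B with
  | nil => simp [spS, shS_nil_left]
  | cons x v ih =>
    induction B generalizing g with
    | nil => simp [spS, shS_nil_right]
    | cons y B ih2 =>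
      rw [shS_cons]
      simp only [spS, shS_add, ih, ih2, spS_add, shS_cons, shS_nil_left, shS_nil_right]
      abel

theorem shS_mid (f : List L → M) (a : L) (w A B : List L) :
    shS f w (A ++ a :: B) =
      spS (fun u v => shS (fun s => shS (fun t => f (s ++ a :: t)) v B) u A) w := by
  induction w generalizing f A with
  | nil => simp [spS, shS_nil_left]
  | cons x w ih =>
    induction A generalizing f with
    | nil =>
      have := ih (fun s => f (x :: s)) []
      simp only [List.nil_append] at this
      simp only [List.nil_append, shS_cons, this, spS, shS_nil_right,
        List.cons_append]
      abel
    | cons y A ih2 =>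
      have := ih (fun s => f (x :: s)) (y :: A)
      simp only [List.cons_append] at this
      simp only [List.cons_append, shS_cons, this, ih2, spS, shS_nil_left, spS_add]
      abel

theorem pairBase_eq (p q : List L × List L) :
    pairBase p q =
      shS (fun s => shS (fun t => Finsupp.single (s, t) (1 : ℤ)) p.2 q.2) p.1 q.1 := by
  unfold pairBase shS
  induction shuffles p.1 q.1 with
  | nil => simp
  | cons x l ih => simp [ih]

/-- Integral as a linear map. -/
noncomputable def integL (a : L) : CalcRr L →ₗ[ℤ] CalcRr L :=
  Finsupp.linearCombination ℤ fun p =>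
    spS (fun u v => Finsupp.single (p.1 ++ a :: u, v) (1 : ℤ)) p.2

/-- Embedding as a linear map. -/
noncomputable def iotaL : CalcR L →ₗ[ℤ] CalcRr L :=
  Finsupp.linearCombination ℤ fun p => spS (fun u v => Finsupp.single (u, v) (1 : ℤ)) p

/-- Product as a bilinear map. -/
noncomputable def pmulL : CalcRr L →ₗ[ℤ] CalcRr L →ₗ[ℤ] CalcRr L :=
  Finsupp.linearCombination ℤ fun p => Finsupp.linearCombination ℤ fun q => pairBase p q

theorem integ0_eq (a : L) (X : CalcRr L) : integ0 a X = integL a X := by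
  simp only [integ0, integL, Finsupp.linearCombination_apply, ← spS_eq]

theorem iotaR_eq (X : CalcR L) : iotaR X = iotaL X := by
  simp only [iotaR, iotaL, Finsupp.linearCombination_apply, ← spS_eq]

theorem pmul_eq (X Y : CalcRr L) : pmul X Y = pmulL X Y := by
  simp only [pmul, pmulL, Finsupp.linearCombination_apply, Finsupp.sum, LinearMap.sum_apply,
    LinearMap.smul_apply, Finset.smul_sum, mul_smul]

theorem pmulL_single (p q : List L × List L) :
    pmulL (Finsupp.single p 1) (Finsupp.single q 1) =
      shS (fun s => shS (fun t => Finsupp.single (s, t) (1 : ℤ)) p.2 q.2) p.1 q.1 := by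
  simp [pmulL, pairBase_eq]

theorem integL_single (a : L) (p : List L × List L) :
    integL a (Finsupp.single p 1) =
      spS (fun u v => Finsupp.single (p.1 ++ a :: u, v) (1 : ℤ)) p.2 := by
  simp [integL]

theorem iotaL_single (w : List L) :
    iotaL (Finsupp.single w 1) = spS (fun u v => Finsupp.single (u, v) (1 : ℤ)) w := by
  simp [iotaL]

theorem integL_shS (a : L) (f : List L → CalcRr L) (xs ys : List L) :
    integL a (shS f xs ys) = shS (fun s => integL a (f s)) xs ys :=
  map_shS (integL a).toAddMonoidHom f xs ys

theorem integL_spS (a : L) (f : List L → List L → CalcRr L) (w : List L) :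
    integL a (spS f w) = spS (fun u v => integL a (f u v)) w :=
  map_spS (integL a).toAddMonoidHom f w

theorem pmulL_spS_right (X : CalcRr L) (f : List L → List L → CalcRr L) (w : List L) :
    pmulL X (spS f w) = spS (fun u v => pmulL X (f u v)) w :=
  map_spS (pmulL X).toAddMonoidHom f w

theorem pmulL_spS_left (Y : CalcRr L) (f : List L → List L → CalcRr L) (w : List L) :
    pmulL (spS f w) Y = spS (fun u v => pmulL (f u v) Y) w :=
  map_spS (pmulL.flip Y).toAddMonoidHom f w

theorem base_case (a : L) (w : List L) (p : List L × List L) :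
    pmulL (iotaL (Finsupp.single w 1)) (integL a (Finsupp.single p 1)) =
      integL a (pmulL (iotaL (Finsupp.single w 1)) (Finsupp.single p 1)) := by
  obtain ⟨A, B⟩ := p
  simp only [iotaL_single, integL_single, pmulL_spS_left, pmulL_spS_right, pmulL_single,
    integL_spS, integL_shS, shS_mid, shS_split, shS_spS]
  rw [← spS_coassoc (fun u v1 v2 => spS (fun B1 B2 =>
    shS (fun s => shS (fun s1 => shS (fun t => Finsupp.single (s ++ a :: s1, t) (1 : ℤ))
      v2 B2) v1 B1) u A) B)]
  rw [spS_spS]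
  congr 1
  funext w1 w2
  conv_lhs => rw [spS_spS]

end Helpers

/-- the integral is linear with respect to multiplication by scalars:
`ι(C) · ∫₀^# D da = ∫₀^# (ι(C) · D) da`. -/
theorem integral_scalar_linear (L : Type) [DecidableEq L] (C : CalcR L) (D : CalcRr L) (a : L) :
    pmul (iotaR C) (integ0 a D) = integ0 a (pmul (iotaR C) D) := by
  simp only [pmul_eq, iotaR_eq, integ0_eq]
  have h : (pmulL.compl₂ (integL a)).comp iotaL = (pmulL.compr₂ (integL a)).comp (iotaL (L := L)) := by
    ext w p : 4
    simpa using base_case a w p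
  exact LinearMap.congr_fun (LinearMap.congr_fun h C) D
end

section
/- (Taylor expansion at 1) For every F ∈ ℛ[r], F = Σ_{k ≥ 0} Σ_{a₁,…,a_k ∈ L} (−1)^k · ι[(∂/∂a₁ ⋯ ∂/∂a_k F)(1)] · (∅⊗(a_k, a_{k−1}, …, a₁)), where only finitely many summands are nonzero. -/
/-- Coefficient form of right multiplication by `∅ ⊗ v`. -/
def qq {L : Type} [DecidableEq L] : (List L → ℤ) → List L → List L → ℤ
  | g, v, [] => if v = [] then g [] else 0
  | g, v, a :: D => qq (fun D' => g (a :: D')) v D +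
      (if v.head? = some a then qq g v.tail D else 0)
  termination_by _ _ D => D.length

theorem qq_nil {L : Type} [DecidableEq L] (g : List L → ℤ) (v : List L) :
    qq g v [] = if v = [] then g [] else 0 := by rw [qq]

theorem qq_cons {L : Type} [DecidableEq L] (g : List L → ℤ) (v : List L) (a : L) (D : List L) :
    qq g v (a :: D) = qq (fun D' => g (a :: D')) v D +
      (if v.head? = some a then qq g v.tail D else 0) := by rw [qq]

theorem qq_zero {L : Type} [DecidableEq L] (D : List L) : ∀ (v : List L),
    qq (fun _ => 0) v D = 0 := by
  induction D with
  | nil => intro v; simp [qq_nil]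
  | cons a D ih => intro v; simp [qq_cons, ih]

theorem qq_add {L : Type} [DecidableEq L] (D : List L) : ∀ (g h : List L → ℤ) (v : List L),
    qq (fun x => g x + h x) v D = qq g v D + qq h v D := by
  induction D with
  | nil => intro g h v; simp only [qq_nil]; split_ifs <;> simp
  | cons a D ih =>
    intro g h v
    simp only [qq_cons, ih]
    split_ifs <;> ring

theorem count_map_cons {L : Type} [DecidableEq L] (x a : L) (D : List L) (l : List (List L)) :
    (l.map (x :: ·)).count (a :: D) = if x = a then l.count D else 0 := by
  induction l with
  | nil => simp
  | cons y l ih =>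
    simp only [List.map_cons, List.count_cons, ih]
    by_cases h : x = a <;> simp [h]

theorem count_map_nil {L : Type} [DecidableEq L] (x : L) (l : List (List L)) :
    (l.map (x :: ·)).count [] = 0 := by
  induction l with
  | nil => simp
  | cons y l ih => simp [List.count_cons, ih]

theorem shuffles_nil_right {L : Type} (B : List L) : shuffles B [] = [B] := by
  cases B <;> simp [shuffles]

theorem qq_single {L : Type} [DecidableEq L] (c : ℤ) (D : List L) : ∀ (B v : List L),
    qq (fun D' => if B = D' then c else 0) v D = c * ((shuffles B v).count D : ℕ) := by
  induction D with
  | nil =>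
    intro B v
    rw [qq_nil]
    rcases B with _ | ⟨x, B⟩ <;> rcases v with _ | ⟨y, v⟩ <;>
      simp [shuffles, List.count_append, count_map_nil]
  | cons a D ih =>
    intro B v
    rw [qq_cons]
    have h0 : ∀ (x : L) (B : List L), (fun D' => if x :: B = a :: D' then c else 0) =
        if x = a then (fun D' => if B = D' then c else 0) else fun _ => 0 := by
      intro x B
      by_cases h : x = a <;> simp [h]
    rcases B with _ | ⟨x, B⟩ <;> rcases v with _ | ⟨y, v⟩
    · simp [shuffles, qq_zero]
    · have := ih [] v
      simp only [shuffles] at this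
      by_cases h : y = a
      · simp only [shuffles, List.head?_cons, List.tail_cons, h, this]
        simp [qq_zero, List.count_cons]
      · simp [shuffles, qq_zero, h]
    · have := ih B []
      rw [shuffles_nil_right] at this
      rw [h0, shuffles_nil_right]
      by_cases h : x = a
      · simp [h, this, List.count_cons]
      · simp [h, qq_zero, List.count_cons]
    · rw [h0]
      have h1 := ih B (y :: v)
      have h2 := ih (x :: B) v
      rw [shuffles, List.count_append, count_map_cons, count_map_cons]
      by_cases h : x = a <;> by_cases h' : y = a <;>
        simp [h, h', qq_zero] <;> subst_vars <;> simp [h1, h2, mul_add]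

theorem sum_single_apply {L : Type} [DecidableEq L] (A C D : List L) (l : List (List L)) :
    ((l.map fun t => Finsupp.single (A, t) (1 : ℤ)).sum) (C, D) =
      if A = C then ((l.count D : ℕ) : ℤ) else 0 := by
  induction l with
  | nil => simp
  | cons y l ih =>
    simp only [List.map_cons, List.sum_cons, Finsupp.add_apply, ih, List.count_cons,
      Finsupp.single_apply, Prod.mk.injEq]
    by_cases h : A = C <;> by_cases h' : y = D <;> simp [h, h', add_comm]

theorem pmul_apply {L : Type} [DecidableEq L] (X : CalcRr L) (v C D : List L) :
    pmul X (Finsupp.single (([] : List L), v) (1 : ℤ)) (C, D) =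
      qq (fun D' => X (C, D')) v D := by
  have e : ∀ X : CalcRr L, pmul X (Finsupp.single (([] : List L), v) (1 : ℤ)) =
      X.sum fun p c => c • pairBase p ([], v) := by
    intro X
    unfold pmul
    congr 1
    funext p c
    rw [Finsupp.sum_single_index] <;> simp
  rw [e]
  induction X using Finsupp.induction_linear with
  | zero => simp [qq_zero]
  | add f g hf hg =>
    rw [Finsupp.sum_add_index' (by simp) (by intros; rw [add_smul])]
    simp only [Finsupp.add_apply, hf, hg, qq_add]
  | single p c =>
    obtain ⟨A, B⟩ := p
    rw [Finsupp.sum_single_index (by simp)]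
    simp only [pairBase, shuffles_nil_right, List.flatMap_cons, List.flatMap_nil, List.append_nil,
      Finsupp.smul_apply, sum_single_apply, smul_eq_mul, Finsupp.single_apply, Prod.mk.injEq]
    by_cases h : A = C
    · simp [h, qq_single]
    · simp [h, qq_zero]

theorem iota_base {L : Type} [DecidableEq L] (A C D : List L) :
    (((List.range (A.length + 1)).map fun k =>
      Finsupp.single (A.take k, A.drop k) (1 : ℤ)).sum) (C, D) =
      if A = C ++ D then 1 else 0 := by
  induction A generalizing C with
  | nil => 
    cases C <;> cases D <;> simp [Finsupp.single_apply]
  | cons x A ih =>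
    rw [List.length_cons, List.range_succ_eq_map]
    simp only [List.map_cons, List.sum_cons, List.map_map, Finsupp.add_apply]
    have key : ∀ l : List ℕ, ((l.map ((fun k =>
        Finsupp.single ((x :: A).take k, (x :: A).drop k) (1 : ℤ)) ∘ Nat.succ)).sum) (C, D) =
        match C with
        | [] => 0
        | y :: C => if x = y then ((l.map fun k =>
            Finsupp.single (A.take k, A.drop k) (1 : ℤ)).sum) (C, D) else 0 := by
      intro l
      induction l with
      | nil => cases C <;> simp
      | cons n l ihl =>
        simp only [List.map_cons, List.sum_cons, Finsupp.add_apply, ihl]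
        cases C with
        | nil => simp [Finsupp.single_apply]
        | cons y C => by_cases h : x = y <;> simp [Finsupp.single_apply, h]
    rw [key]
    cases C with
    | nil => simp [Finsupp.single_apply]
    | cons y C =>
      simp only [ih]
      by_cases h : x = y <;> simp [Finsupp.single_apply, h]

theorem iota_apply {L : Type} [DecidableEq L] (X : CalcR L) (C D : List L) :
    iotaR X (C, D) = X (C ++ D) := by
  unfold iotaR
  induction X using Finsupp.induction_linear with
  | zero => simp
  | add f g hf hg =>
    rw [Finsupp.sum_add_index' (by simp) (by intros; rw [add_smul])]
    simp only [Finsupp.add_apply, hf, hg]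
  | single A c =>
    rw [Finsupp.sum_single_index (by simp), Finsupp.smul_apply, iota_base]
    simp [Finsupp.single_apply]

theorem ev1_apply {L : Type} [DecidableEq L] (X : CalcRr L) (E : List L) :
    ev1 X E = X (E, []) := by
  unfold ev1
  induction X using Finsupp.induction_linear with
  | zero => simp
  | add f g hf hg =>
    rw [Finsupp.sum_add_index' (by simp) (by intros; split_ifs <;> simp)]
    simp only [Finsupp.add_apply, hf, hg]
  | single p c =>
    obtain ⟨A, B⟩ := p
    rw [Finsupp.sum_single_index (by simp)]
    by_cases h : B = [] <;> simp [Finsupp.single_apply, h]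

theorem pderiv_apply {L : Type} [DecidableEq L] (a : L) (X : CalcRr L) (C D : List L) :
    pderiv a X (C, D) = X (C ++ [a], D) - X (C, a :: D) := by
  unfold pderiv
  induction X using Finsupp.induction_linear with
  | zero => simp
  | add f g hf hg =>
    rw [Finsupp.sum_add_index' (by simp) (by intros; rw [add_smul])]
    simp only [Finsupp.add_apply, hf, hg]
    ring
  | single p c =>
    obtain ⟨A, B⟩ := p
    rw [Finsupp.sum_single_index (by simp), Finsupp.smul_apply, Finsupp.sub_apply, smul_eq_mul,
      mul_sub]
    congr 1
    · rcases List.eq_nil_or_concat A with h | ⟨A, x, h⟩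
      · subst h; simp [Finsupp.single_apply]
      · subst h
        by_cases h : x = a <;> simp [Finsupp.single_apply, h]
    · cases B with
      | nil => simp [Finsupp.single_apply]
      | cons x B => by_cases h : x = a <;> simp [Finsupp.single_apply, h]

theorem derivs_append {L : Type} [DecidableEq L] (w : List L) (a : L) (F : CalcRr L) :
    derivs (w ++ [a]) F = derivs w (pderiv a F) := by
  induction w with
  | nil => rfl
  | cons b w ih => simp only [List.cons_append, derivs, ih]

theorem derivs_zero {L : Type} [DecidableEq L] (w : List L) :
    derivs w (0 : CalcRr L) = 0 := by
  induction w with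
  | nil => rfl
  | cons b w ih => simp [derivs, ih, pderiv]

theorem derivs_finite {L : Type} [DecidableEq L] (n : ℕ) : ∀ F : CalcRr L,
    (∀ p, F p ≠ 0 → p.1.length + p.2.length < n) → {v : List L | derivs v.reverse F ≠ 0}.Finite := by
  induction n with
  | zero =>
    intro F hF
    have : F = 0 := by
      ext p
      by_contra h
      exact absurd (hF p h) (by simp)
    subst this
    simp [derivs_zero]
  | succ n ih =>
    intro F hF
    let S : Finset L := F.support.biUnion fun p => p.1.toFinset ∪ p.2.toFinset
    have hfin : ({[]} ∪ ⋃ a ∈ S, (fun v => a :: v) ''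
        {v : List L | derivs v.reverse (pderiv a F) ≠ 0}).Finite := by
      refine (Set.finite_singleton _).union (S.finite_toSet.biUnion fun a _ => Set.Finite.image _ ?_)
      apply ih
      rintro ⟨C, D⟩ h
      rw [pderiv_apply] at h
      by_cases h1 : F (C ++ [a], D) = 0
      · have h2 : F (C, a :: D) ≠ 0 := by
          intro h2; simp [h1, h2] at h
        have := hF _ h2
        simp at this ⊢
        omega
      · have := hF _ h1
        simp at this ⊢
        omega
    refine hfin.subset ?_
    intro v hv
    cases v with
    | nil => simp
    | cons a v =>
      right
      simp only [Set.mem_setOf_eq, List.reverse_cons, derivs_append] at hv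
      simp only [Set.mem_iUnion]
      refine ⟨a, ?_, v, hv, rfl⟩
      by_contra ha
      apply hv
      have : pderiv a F = 0 := by
        ext ⟨C, D⟩
        rw [pderiv_apply]
        have h1 : F (C ++ [a], D) = 0 := by
          by_contra h
          exact ha (Finset.mem_biUnion.2 ⟨_, Finsupp.mem_support_iff.2 h, by simp⟩)
        have h2 : F (C, a :: D) = 0 := by
          by_contra h
          exact ha (Finset.mem_biUnion.2 ⟨_, Finsupp.mem_support_iff.2 h, by simp⟩)
        simp [h1, h2]
      rw [this, derivs_zero]

theorem derivs_finite' {L : Type} [DecidableEq L] (F : CalcRr L) :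
    {v : List L | derivs v.reverse F ≠ 0}.Finite := by
  refine derivs_finite (F.support.sup (fun p => p.1.length + p.2.length) + 1) F ?_
  intro p hp
  exact Nat.lt_succ_of_le (Finset.le_sup (f := fun p : List L × List L => p.1.length + p.2.length)
    (Finsupp.mem_support_iff.2 hp))

theorem coeff_sum {L : Type} [DecidableEq L] (D : List L) : ∀ (F : CalcRr L) (C : List L),
    ∑ᶠ v : List L, (-1 : ℤ) ^ v.length *
      qq (fun D' => derivs v.reverse F (C ++ D', [])) v D = F (C, D) := by
  induction D with
  | nil =>
    intro F C
    rw [finsum_eq_single _ ([] : List L)]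
    · simp [qq_nil, derivs]
    · intro v hv
      simp [qq_nil, hv]
  | cons a D ih =>
    intro F C
    have i1 := ih F (C ++ [a])
    have i2 := ih (pderiv a F) C
    rw [pderiv_apply] at i2
    simp only [List.append_assoc, List.singleton_append] at i1
    simp only [qq_cons, mul_add]
    rw [finsum_add_distrib, i1]
    · have inj : Function.Injective (fun v : List L => a :: v) := fun _ _ h => by simpa using h
      have : ∑ᶠ v : List L, (-1 : ℤ) ^ v.length * (if v.head? = some a then
          qq (fun D' => derivs v.reverse F (C ++ D', [])) v.tail D else 0) =
          ∑ᶠ v : List L, -((-1 : ℤ) ^ v.length *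
            qq (fun D' => derivs v.reverse (pderiv a F) (C ++ D', [])) v D) := by
        have h1 := finsum_mem_range (f := fun v : List L => (-1 : ℤ) ^ v.length *
          (if v.head? = some a then
            qq (fun D' => derivs v.reverse F (C ++ D', [])) v.tail D else 0)) inj
        rw [finsum_mem_inter_support_eq (t := Set.univ), finsum_mem_univ] at h1
        · rw [h1]
          apply finsum_congr
          intro v
          simp [derivs_append, pow_succ]
        · ext v
          simp only [Set.mem_inter_iff, Set.mem_univ, true_and, and_iff_right_iff_imp]
          intro hv
          cases v with
          | nil => simp at hv
          | cons b v =>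
            by_cases h : b = a
            · exact ⟨v, by simp [h]⟩
            · simp [h] at hv
      rw [this, finsum_neg_distrib, i2]
      ring
    · refine (derivs_finite' F).subset ?_
      intro v hv h
      apply hv
      simp [h, qq_zero]
    · refine (derivs_finite' F).subset ?_
      intro v hv h
      apply hv
      simp [h, qq_zero]

/-- Taylor expansion at `1`:
`F = Σ_{k≥0} Σ_{a₁,…,a_k ∈ L} (-1)^k ι[(∂/∂a₁ ⋯ ∂/∂a_k F)(1)] · (∅ ⊗ (a_k,…,a₁))`, the
(finitely supported) sum running over all tuples `w = (a₁,…,a_k)` of labels. -/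
theorem taylor_at_one (L : Type) [DecidableEq L] (F : CalcRr L) :
    F = ∑ᶠ w : List L, ((-1 : ℤ) ^ w.length) •
      pmul (iotaR (ev1 (derivs w F))) (Finsupp.single (([] : List L), w.reverse) (1 : ℤ)) := by
  ext ⟨C, D⟩
  have hfin : (Function.support fun w : List L => ((-1 : ℤ) ^ w.length) •
      pmul (iotaR (ev1 (derivs w F)))
        (Finsupp.single (([] : List L), w.reverse) (1 : ℤ))).Finite := by
    refine ((derivs_finite' F).image List.reverse).subset ?_
    intro w hw
    refine ⟨w.reverse, ?_, by simp⟩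
    intro h
    apply hw
    simp only [List.reverse_reverse] at h
    simp [h, ev1, iotaR, pmul]
  have := AddMonoidHom.map_finsum (Finsupp.applyAddHom (C, D) : CalcRr L →+ ℤ) hfin
  simp only [Finsupp.applyAddHom_apply] at this
  rw [this, ← coeff_sum D F C]
  let e : List L ≃ List L := ⟨List.reverse, List.reverse, by intro; simp, by intro; simp⟩
  rw [← finsum_comp_equiv e]
  apply finsum_congr
  intro v
  simp only [e, Equiv.coe_fn_mk, List.length_reverse, List.reverse_reverse, Finsupp.smul_apply,
    pmul_apply, iota_apply, ev1_apply, smul_eq_mul]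
end
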